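/- Let Ω ⊆ ℝⁿ be a domain, (Y,d) a metric space, 1 ≤ q ≤ ∞, and φ : Ω → Y a mapping such that for every Lipschitz function u : Y → ℝ the composition u∘φ is locally integrable on Ω and has a weak gradient v_u whose norm ‖v_u‖ lies in L_q(Ω). Then the composition operator is automatically bounded: there exists a constant A ≥ 0 such that ‖ ‖v_u‖ ‖_{L_q(Ω)} ≤ A·Lip(u) for every Lipschitz u : Y → ℝ. -/

import Mathlib

open MeasureTheory Set
open scoped ENNReal Topology NNReal

noncomputable section

/-- `f` has weak gradient `v` on the open set `Ω ⊆ ℝⁿ`. -/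
def HasWeakGradOn {n : ℕ} (f : EuclideanSpace ℝ (Fin n) → ℝ)
    (v : EuclideanSpace ℝ (Fin n) → EuclideanSpace ℝ (Fin n))
    (Ω : Set (EuclideanSpace ℝ (Fin n))) : Prop :=
  LocallyIntegrableOn f Ω volume ∧ LocallyIntegrableOn v Ω volume ∧
    ∀ ψ : EuclideanSpace ℝ (Fin n) → ℝ, ContDiff ℝ (⊤ : ℕ∞) ψ → HasCompactSupport ψ →
      tsupport ψ ⊆ Ω →
      ∫ x in Ω, f x • gradient ψ x = - ∫ x in Ω, ψ x • v x

/-- `u : Y → ℝ` is a Lipschitz function. -/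
def IsLipschitz {Y : Type*} [MetricSpace Y] (u : Y → ℝ) : Prop :=
  ∃ L : ℝ, 0 ≤ L ∧ ∀ y₁ y₂, |u y₁ - u y₂| ≤ L * dist y₁ y₂

/-- the least Lipschitz constant of `u`. -/
def lipConst {Y : Type*} [MetricSpace Y] (u : Y → ℝ) : ℝ :=
  sInf {L : ℝ | 0 ≤ L ∧ ∀ y₁ y₂, |u y₁ - u y₂| ≤ L * dist y₁ y₂}

/-- distance between two sets, `+∞` when one is empty. -/
def eSetDist {Y : Type*} [PseudoEMetricSpace Y] (A B : Set Y) : ℝ≥0∞ :=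
  ⨅ y ∈ A, ⨅ z ∈ B, edist y z

/-- The set function `Φ` associated to the composition operator. -/
def Phi {n : ℕ} {Y : Type*} [MetricSpace Y] (q : ℝ)
    (φ : EuclideanSpace ℝ (Fin n) → Y) (Ω : Set (EuclideanSpace ℝ (Fin n)))
    (V : Set Y) : ℝ :=
  sSup {I : ℝ | ∃ (u : Y → ℝ) (v : EuclideanSpace ℝ (Fin n) → EuclideanSpace ℝ (Fin n)),
    LipschitzWith 1 u ∧ 0 < eSetDist (tsupport u) Vᶜ ∧
    HasWeakGradOn (u ∘ φ) v Ω ∧ IntegrableOn (fun x => ‖v x‖ ^ q) Ω volume ∧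
    I = ∫ x in Ω, ‖v x‖ ^ q}

theorem aux_int_smul {n : ℕ} {F : Type*} [NormedAddCommGroup F] [NormedSpace ℝ F]
    {Ω : Set (EuclideanSpace ℝ (Fin n))}
    {f : EuclideanSpace ℝ (Fin n) → F} {g : EuclideanSpace ℝ (Fin n) → ℝ}
    (hf : LocallyIntegrableOn f Ω volume) (hg : Continuous g) (hc : HasCompactSupport g)
    (hs : tsupport g ⊆ Ω) : Integrable (fun x => g x • f x) volume := by
  have h1 : IntegrableOn f (tsupport g) volume := hf.integrableOn_compact_subset hs hc
  have h2 := h1.continuousOn_smul hg.continuousOn hc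
  refine (integrableOn_iff_integrable_of_support_subset ?_).1 h2
  refine Function.support_subset_iff'.2 fun x hx => ?_
  simp [image_eq_zero_of_notMem_tsupport hx]

theorem aux_int_smul' {n : ℕ} {Ω : Set (EuclideanSpace ℝ (Fin n))}
    {f : EuclideanSpace ℝ (Fin n) → ℝ}
    {g : EuclideanSpace ℝ (Fin n) → EuclideanSpace ℝ (Fin n)}
    (hf : LocallyIntegrableOn f Ω volume) (hg : Continuous g) (hc : HasCompactSupport g)
    (hs : tsupport g ⊆ Ω) : Integrable (fun x => f x • g x) volume := by
  have h1 : IntegrableOn f (tsupport g) volume := hf.integrableOn_compact_subset hs hc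
  have h2 := h1.smul_continuousOn hg.continuousOn hc
  refine (integrableOn_iff_integrable_of_support_subset ?_).1 h2
  refine Function.support_subset_iff'.2 fun x hx => ?_
  simp [image_eq_zero_of_notMem_tsupport hx]

theorem aux_grad {n : ℕ} {ψ : EuclideanSpace ℝ (Fin n) → ℝ}
    (hψ : ContDiff ℝ (⊤ : ℕ∞) ψ) (hc : HasCompactSupport ψ) :
    Continuous (gradient ψ) ∧ HasCompactSupport (gradient ψ) ∧
      tsupport (gradient ψ) ⊆ tsupport ψ := by
  have h1 : tsupport (gradient ψ) ⊆ tsupport ψ := by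
    refine closure_minimal (fun x hx => ?_) (isClosed_tsupport _)
    apply support_fderiv_subset ℝ
    intro h0
    apply hx
    simp [gradient, h0]
  refine ⟨?_, IsCompact.of_isClosed_subset hc (isClosed_tsupport _) h1, h1⟩
  · exact (LinearIsometryEquiv.continuous _).comp (hψ.continuous_fderiv (by simp))

theorem aux_grad_int {n : ℕ} {Ω : Set (EuclideanSpace ℝ (Fin n))}
    {ψ : EuclideanSpace ℝ (Fin n) → ℝ}
    (hψ : ContDiff ℝ (⊤ : ℕ∞) ψ) (hc : HasCompactSupport ψ) (hs : tsupport ψ ⊆ Ω) :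
    ∫ x in Ω, gradient ψ x = 0 := by
  obtain ⟨g1, g2, g3⟩ := aux_grad hψ hc
  rw [setIntegral_eq_integral_of_forall_compl_eq_zero
    (fun x hx => image_eq_zero_of_notMem_tsupport fun h => hx (hs (g3 h)))]
  have hi : Integrable (gradient ψ) volume := g1.integrable_of_hasCompactSupport g2
  refine ext_inner_right ℝ fun v => ?_
  have hI : Integrable (fun x => fderiv ℝ ψ x v) volume := by
    refine (hi.inner_const (𝕜 := ℝ) v).congr (Filter.Eventually.of_forall fun x => ?_)
    simp [gradient]
  have key := integral_mul_fderiv_eq_neg_fderiv_mul_of_integrable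
    (μ := (volume : Measure (EuclideanSpace ℝ (Fin n)))) (𝕜 := ℝ) (f := fun _ => (1 : ℝ)) (g := ψ)
    (v := v) (by simp) (by simpa using hI)
    (by simpa using hψ.continuous.integrable_of_hasCompactSupport hc)
    (fun x _ => by fun_prop) (fun x _ => hψ.differentiable (by simp) x)
  rw [inner_zero_left, real_inner_comm, ← integral_inner hi v]
  simp at key
  rw [← key]
  refine integral_congr_ae (Filter.Eventually.of_forall fun x => ?_)
  change inner ℝ v (gradient ψ x) = fderiv ℝ ψ x v
  rw [real_inner_comm]
  simp [gradient]

theorem aux_unique {n : ℕ} {Ω : Set (EuclideanSpace ℝ (Fin n))} (hΩo : IsOpen Ω)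
    {f : EuclideanSpace ℝ (Fin n) → ℝ}
    {v w : EuclideanSpace ℝ (Fin n) → EuclideanSpace ℝ (Fin n)}
    (hv : HasWeakGradOn f v Ω) (hw : HasWeakGradOn f w Ω) :
    v =ᵐ[volume.restrict Ω] w := by
  have := hΩo.ae_eq_zero_of_integral_contDiff_smul_eq_zero (μ := volume)
    (hv.2.1.sub hw.2.1) (fun g hg hc hs => by
      have h1 := hv.2.2 g hg hc hs
      rw [hw.2.2 g hg hc hs] at h1
      have iv := aux_int_smul hv.2.1 hg.continuous hc hs
      have iw := aux_int_smul hw.2.1 hg.continuous hc hs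
      rw [setIntegral_eq_integral_of_forall_compl_eq_zero
        (fun x hx => by simp [image_eq_zero_of_notMem_tsupport fun h => hx (hs h)]),
        setIntegral_eq_integral_of_forall_compl_eq_zero
        (fun x hx => by simp [image_eq_zero_of_notMem_tsupport fun h => hx (hs h)])] at h1
      simp only [Pi.sub_apply, smul_sub]
      rw [integral_sub iv iw, neg_inj.1 h1, sub_self])
  rw [Filter.EventuallyEq, ae_restrict_iff' hΩo.measurableSet]
  filter_upwards [this] with x hx hxΩ
  exact sub_eq_zero.1 (hx hxΩ)

theorem aux_add {n : ℕ} {Ω : Set (EuclideanSpace ℝ (Fin n))}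
    {f g : EuclideanSpace ℝ (Fin n) → ℝ}
    {v w : EuclideanSpace ℝ (Fin n) → EuclideanSpace ℝ (Fin n)}
    (hv : HasWeakGradOn f v Ω) (hw : HasWeakGradOn g w Ω) :
    HasWeakGradOn (f + g) (v + w) Ω := by
  refine ⟨hv.1.add hw.1, hv.2.1.add hw.2.1, fun ψ hψ hc hs => ?_⟩
  obtain ⟨g1, g2, g3⟩ := aux_grad hψ hc
  simp only [Pi.add_apply, add_smul, smul_add]
  rw [integral_add (aux_int_smul' hv.1 g1 g2 (g3.trans hs)).integrableOn
    (aux_int_smul' hw.1 g1 g2 (g3.trans hs)).integrableOn,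
    integral_add (aux_int_smul hv.2.1 hψ.continuous hc hs).integrableOn
    (aux_int_smul hw.2.1 hψ.continuous hc hs).integrableOn,
    hv.2.2 ψ hψ hc hs, hw.2.2 ψ hψ hc hs, neg_add]

theorem aux_smul {n : ℕ} {Ω : Set (EuclideanSpace ℝ (Fin n))}
    {f : EuclideanSpace ℝ (Fin n) → ℝ}
    {v : EuclideanSpace ℝ (Fin n) → EuclideanSpace ℝ (Fin n)} (c : ℝ)
    (hv : HasWeakGradOn f v Ω) :
    HasWeakGradOn (c • f) (c • v) Ω := by
  refine ⟨hv.1.smul c, hv.2.1.smul c, fun ψ hψ hc hs => ?_⟩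
  simp only [Pi.smul_apply, smul_assoc, smul_comm _ c]
  rw [integral_smul, integral_smul, hv.2.2 ψ hψ hc hs, smul_neg]

theorem aux_const {n : ℕ} {Ω : Set (EuclideanSpace ℝ (Fin n))} (c : ℝ) :
    HasWeakGradOn (fun _ => c) (0 : EuclideanSpace ℝ (Fin n) → EuclideanSpace ℝ (Fin n)) Ω := by
  refine ⟨(locallyIntegrable_const c).locallyIntegrableOn _,
    locallyIntegrable_zero.locallyIntegrableOn _, fun ψ hψ hc hs => ?_⟩
  rw [integral_smul, aux_grad_int hψ hc hs]
  simp

/-- The space of (normalised difference quotients of) Lipschitz functions. -/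
def LipSp (Y : Type*) [MetricSpace Y] : Submodule ℝ (lp (fun _ : Y × Y => ℝ) ∞) where
  carrier := {g | ∀ a b c, g (a, b) * dist a b + g (b, c) * dist b c = g (a, c) * dist a c}
  add_mem' := by
    intro g h hg hh a b c
    simp only [lp.coeFn_add, Pi.add_apply]
    linear_combination hg a b c + hh a b c
  zero_mem' := by
    intro a b c
    simp
  smul_mem' := by
    intro r g hg a b c
    simp only [lp.coeFn_smul, Pi.smul_apply, smul_eq_mul]
    linear_combination r * hg a b c

theorem LipSp_closed (Y : Type*) [MetricSpace Y] :
    IsClosed (LipSp Y : Set (lp (fun _ : Y × Y => ℝ) ∞)) := by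
  have hc : ∀ i : Y × Y, Continuous fun g : lp (fun _ : Y × Y => ℝ) ∞ => g i :=
    fun i => (lp.evalCLM ℝ (fun _ : Y × Y => ℝ) ∞ i).continuous
  have : (LipSp Y : Set (lp (fun _ : Y × Y => ℝ) ∞)) = ⋂ a, ⋂ b, ⋂ c,
      {g | g (a, b) * dist a b + g (b, c) * dist b c = g (a, c) * dist a c} := by
    ext g
    simp [LipSp]
  rw [this]
  refine isClosed_iInter fun a => isClosed_iInter fun b => isClosed_iInter fun c => ?_
  exact isClosed_eq (((hc _).mul continuous_const).add ((hc _).mul continuous_const))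
    ((hc _).mul continuous_const)

/-- The Lipschitz function vanishing at `y0` attached to an element of `LipSp`. -/
def lipFun {Y : Type*} [MetricSpace Y] (y0 : Y) (g : LipSp Y) : Y → ℝ :=
  fun y => g.1 (y, y0) * dist y y0

theorem lipFun_lip {Y : Type*} [MetricSpace Y] (y0 : Y) (g : LipSp Y) (a b : Y) :
    |lipFun y0 g a - lipFun y0 g b| ≤ ‖g‖ * dist a b := by
  have h := g.2 a b y0
  have : lipFun y0 g a - lipFun y0 g b = g.1 (a, b) * dist a b := by
    simp only [lipFun]
    linarith
  rw [this, abs_mul, abs_of_nonneg (dist_nonneg (x := a) (y := b))]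
  exact mul_le_mul_of_nonneg_right (lp.norm_apply_le_norm (by simp) g.1 (a, b)) dist_nonneg

theorem lipFun_isLip {Y : Type*} [MetricSpace Y] (y0 : Y) (g : LipSp Y) :
    IsLipschitz (lipFun y0 g) :=
  ⟨‖g‖, norm_nonneg _, lipFun_lip y0 g⟩

theorem lipFun_abs {Y : Type*} [MetricSpace Y] (y0 : Y) (g : LipSp Y) (a : Y) :
    |lipFun y0 g a| ≤ ‖g‖ * dist a y0 := by
  have := lipFun_lip y0 g a y0
  simpa [lipFun] using this

theorem lipConst_spec {Y : Type*} [MetricSpace Y] {u : Y → ℝ} (hu : IsLipschitz u) :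
    0 ≤ lipConst u ∧ ∀ a b, |u a - u b| ≤ lipConst u * dist a b := by
  have h0 : 0 ≤ lipConst u := Real.sInf_nonneg fun L hL => hL.1
  refine ⟨h0, fun a b => ?_⟩
  rcases (dist_nonneg (x := a) (y := b)).eq_or_lt with h | h
  · obtain rfl := dist_eq_zero.1 h.symm
    simp
  · rw [← div_le_iff₀ h]
    refine le_csInf hu fun L hL => ?_
    rw [div_le_iff₀ h]
    exact hL.2 a b

theorem exists_lipFun {Y : Type*} [MetricSpace Y] (y0 : Y) {u : Y → ℝ} (hu : IsLipschitz u) :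
    ∃ g : LipSp Y, ‖g‖ ≤ lipConst u ∧ ∀ y, lipFun y0 g y = u y - u y0 := by
  obtain ⟨h0, h1⟩ := lipConst_spec hu
  let G : Y × Y → ℝ := fun p => (u p.1 - u p.2) / dist p.1 p.2
  have hG : ∀ p, ‖G p‖ ≤ lipConst u := by
    intro p
    simp only [G, norm_div, Real.norm_eq_abs, abs_of_nonneg dist_nonneg]
    exact div_le_of_le_mul₀ dist_nonneg h0 (h1 _ _)
  have hGd : ∀ a b, G (a, b) * dist a b = u a - u b := by
    intro a b
    by_cases h : a = b
    · simp [h]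
    · exact div_mul_cancel₀ _ (dist_ne_zero.2 h)
  let g : lp (fun _ : Y × Y => ℝ) ∞ :=
    ⟨G, memℓp_infty ⟨lipConst u, by rintro _ ⟨p, rfl⟩; exact hG p⟩⟩
  refine ⟨⟨g, fun a b c => ?_⟩, lp.norm_le_of_forall_le h0 hG, fun y => hGd y y0⟩
  change G (a, b) * dist a b + G (b, c) * dist b c = G (a, c) * dist a c
  rw [hGd, hGd, hGd]
  ring

/-- closed graph. If `u∘φ` has a weak gradient with finite `L_q`-norm for
every Lipschitz `u : Y → ℝ`, then the composition operator is automatically bounded. -/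
theorem composition_operator_automatically_bounded
    {n : ℕ} (hn : 0 < n) {Y : Type*} [MetricSpace Y]
    (Ω : Set (EuclideanSpace ℝ (Fin n))) (hΩo : IsOpen Ω) (hΩc : IsConnected Ω)
    (q : ℝ≥0∞) (hq : 1 ≤ q)
    (φ : EuclideanSpace ℝ (Fin n) → Y)
    (hyp : ∀ u : Y → ℝ, IsLipschitz u →
      ∃ v, HasWeakGradOn (u ∘ φ) v Ω ∧ eLpNorm v q (volume.restrict Ω) < ⊤) :
    ∃ A : ℝ, 0 ≤ A ∧ ∀ u : Y → ℝ, IsLipschitz u →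
      ∀ v : EuclideanSpace ℝ (Fin n) → EuclideanSpace ℝ (Fin n),
        HasWeakGradOn (u ∘ φ) v Ω →
        eLpNorm v q (volume.restrict Ω) ≤ ENNReal.ofReal (A * lipConst u) := by
  obtain ⟨x0, hx0⟩ := hΩc.nonempty
  let y0 := φ x0
  have : Fact (1 ≤ q) := ⟨hq⟩
  have : CompleteSpace (LipSp Y) := (LipSp_closed Y).completeSpace_coe
  let μ : Measure (EuclideanSpace ℝ (Fin n)) := volume.restrict Ω
  choose V hV using fun g : LipSp Y => hyp (lipFun y0 g) (lipFun_isLip y0 g)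
  have hmem : ∀ g, MemLp (V g) q μ := fun g => ⟨(hV g).1.2.1.aestronglyMeasurable, (hV g).2⟩
  let T : LipSp Y →ₗ[ℝ] Lp (EuclideanSpace ℝ (Fin n)) q μ :=
    { toFun := fun g => (hmem g).toLp
      map_add' := by
        intro g h
        rw [← MemLp.toLp_add, MemLp.toLp_eq_toLp_iff]
        refine aux_unique hΩo (hV (g + h)).1 ?_
        convert aux_add (hV g).1 (hV h).1 using 1
        ext x
        simp [lipFun, add_mul]
      map_smul' := by
        intro c g
        rw [RingHom.id_apply, ← MemLp.toLp_const_smul, MemLp.toLp_eq_toLp_iff]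
        refine aux_unique hΩo (hV (c • g)).1 ?_
        convert aux_smul c (hV g).1 using 1
        ext x
        simp [lipFun, mul_assoc] }
  have hT : Continuous T := by
    refine T.continuous_of_seq_closed_graph fun U g w hU hw => ?_
    have hwg : HasWeakGradOn (lipFun y0 g ∘ φ) w Ω := by
      refine ⟨(hV g).1.1, ?_, fun ψ hψ hc hs => ?_⟩
      · exact locallyIntegrableOn_of_locallyIntegrable_restrict
          ((Lp.memLp w).locallyIntegrable hq)
      obtain ⟨g1, g2, g3⟩ := aux_grad hψ hc
      have : ENNReal.HolderConjugate (1 - q⁻¹)⁻¹ q := 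
        (ENNReal.HolderConjugate.inv_one_sub_inv' hq).symm
      have : Fact (1 ≤ (1 - q⁻¹)⁻¹) := ⟨by simp [ENNReal.one_le_inv]⟩
      have hψm : MemLp ψ (1 - q⁻¹)⁻¹ μ := hψ.continuous.memLp_of_hasCompactSupport hc
      let P := (ContinuousLinearMap.lsmul ℝ ℝ (E := EuclideanSpace ℝ (Fin n))).lpPairing μ
        (1 - q⁻¹)⁻¹ q hψm.toLp
      have hP : ∀ (z : Lp (EuclideanSpace ℝ (Fin n)) q μ)
          (z' : EuclideanSpace ℝ (Fin n) → EuclideanSpace ℝ (Fin n)), z =ᵐ[μ] z' →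
          P z = ∫ x in Ω, ψ x • z' x := by
        intro z z' hz
        simp only [P]
        rw [ContinuousLinearMap.lpPairing_eq_integral]
        refine integral_congr_ae ?_
        filter_upwards [hψm.coeFn_toLp, hz] with x h1 h2
        simp [h1, h2]
      have lim1 : Filter.Tendsto (fun k => - P (T (U k))) Filter.atTop (𝓝 (- P w)) :=
        ((P.continuous.tendsto w).comp hw).neg
      have hInt : ∀ h, Integrable (fun x => lipFun y0 h (φ x) • gradient ψ x) μ := fun h =>
        (aux_int_smul' (hV h).1.1 g1 g2 (g3.trans hs)).integrableOn
      have hd : IsLipschitz (fun y => dist y y0) := ⟨1, zero_le_one, fun a b => by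
        rw [one_mul]; exact abs_dist_sub_le a b y0⟩
      obtain ⟨vd, hvd, -⟩ := hyp _ hd
      have hdi : Integrable (fun x => dist (φ x) y0 • gradient ψ x) μ :=
        (aux_int_smul' hvd.1 g1 g2 (g3.trans hs)).integrableOn
      let S : LipSp Y →ₗ[ℝ] EuclideanSpace ℝ (Fin n) :=
        { toFun := fun h => ∫ x, lipFun y0 h (φ x) • gradient ψ x ∂μ
          map_add' := by
            intro h k
            rw [← integral_add (hInt h) (hInt k)]
            congr 1
            ext1 x
            simp [lipFun, add_mul, add_smul]
          map_smul' := by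
            intro c h
            rw [RingHom.id_apply, ← integral_smul]
            congr 1
            ext1 x
            simp [lipFun, smul_smul, mul_assoc] }
      have hS : Continuous S := by
        refine AddMonoidHomClass.continuous_of_bound S
          (∫ x, ‖dist (φ x) y0 • gradient ψ x‖ ∂μ) fun h => ?_
        rw [mul_comm, ← integral_const_mul]
        refine norm_integral_le_of_norm_le (hdi.norm.const_mul _)
          (Filter.Eventually.of_forall fun x => ?_)
        rw [norm_smul, norm_smul, ← mul_assoc, Real.norm_eq_abs, Real.norm_eq_abs,
          abs_of_nonneg (dist_nonneg (x := φ x) (y := y0))]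
        exact mul_le_mul_of_nonneg_right (lipFun_abs y0 h (φ x)) (norm_nonneg _)
      have lim2 : Filter.Tendsto (fun k => S (U k)) Filter.atTop (𝓝 (S g)) :=
        (hS.tendsto g).comp hU
      have heq : ∀ k, S (U k) = - P (T (U k)) := by
        intro k
        rw [hP (T (U k)) _ (hmem (U k)).coeFn_toLp]
        exact (hV (U k)).1.2.2 ψ hψ hc hs
      have := tendsto_nhds_unique (lim2.congr heq) lim1
      rw [hP w w Filter.EventuallyEq.rfl] at this
      exact this
    refine Lp.ext ?_
    exact (aux_unique hΩo hwg (hV g).1).trans (hmem g).coeFn_toLp.symm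
  let TL : LipSp Y →L[ℝ] Lp (EuclideanSpace ℝ (Fin n)) q μ := ⟨T, hT⟩
  refine ⟨‖TL‖, norm_nonneg TL, fun u hu v hv => ?_⟩
  obtain ⟨g, hg, hgu⟩ := exists_lipFun y0 hu
  have hv' : HasWeakGradOn (lipFun y0 g ∘ φ) v Ω := by
    convert aux_add hv (aux_const (-u y0)) using 1
    · ext x
      simp [hgu, sub_eq_add_neg]
    · simp
  rw [eLpNorm_congr_ae (aux_unique hΩo hv' (hV g).1), ← Lp.enorm_toLp (hmem g),
    ← ofReal_norm]
  refine ENNReal.ofReal_le_ofReal ?_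
  exact (TL.le_opNorm g).trans (mul_le_mul_of_nonneg_left hg (norm_nonneg TL))
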